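/- Let Ω ⊂ ℝⁿ be a convex open set and u ∈ W^{1,1}_0(Ω; ℝ) (extended by 0 outside Ω). Then there is a dimensional constant C = C(n) such that for all λ, μ > 0, u is asymmetrically (Cλ, Cμ)-Lipschitz continuous on the set Y = (X ∩ Ω) ∪ ∂Ω, where X = {N(∇u)₊ ≤ λ} ∩ {N(∇u)₋ ≤ μ}. -/

import Mathlib

open MeasureTheory ENNReal

/-- The asymmetric distance on `ℝ`: `d_{λ,μ}(t) = λt` for `t ≥ 0` and `-μt` for `t < 0`. -/
noncomputable def dAs (lam mu t : ℝ) : ℝ := if 0 ≤ t then lam * t else -(mu * t)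

/-- The asymmetric distance on `ℝⁿ`: `d_{λ,μ}(x,y) = ∑ᵢ d_{λ,μ}(xᵢ - yᵢ)`. -/
noncomputable def dAsV {n : ℕ} (lam mu : ℝ) (x y : Fin n → ℝ) : ℝ :=
  ∑ i, dAs lam mu (x i - y i)

/-- The open axis-parallel rectangle `∏ᵢ (xᵢ - rᵢ, xᵢ + rᵢ)`. -/
def rect {n : ℕ} (x r : Fin n → ℝ) : Set (Fin n → ℝ) :=
  Set.univ.pi fun i => Set.Ioo (x i - r i) (x i + r i)

/-- The strong (rectangular) maximal operator. -/
noncomputable def strongMax {n : ℕ} (u : (Fin n → ℝ) → ℝ) (x : Fin n → ℝ) : ℝ≥0∞ :=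
  ⨆ r : {r : Fin n → ℝ // ∀ i, 0 < r i},
    (∫⁻ z in rect x (r : Fin n → ℝ), ENNReal.ofReal |u z|) / volume (rect x (r : Fin n → ℝ))

/-- `g` is the weak (distributional) gradient of `u`. -/
def IsWeakGrad {n : ℕ} (u : (Fin n → ℝ) → ℝ) (g : (Fin n → ℝ) → (Fin n → ℝ)) : Prop :=
  ∀ φ : (Fin n → ℝ) → ℝ, ContDiff ℝ (⊤ : ℕ∞) φ → HasCompactSupport φ → ∀ i : Fin n,
    ∫ x, u x * fderiv ℝ φ x (Pi.single i 1) = - ∫ x, g x i * φ x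

/-- `x` is a Lebesgue point of `u`. -/
def LebPoint {n : ℕ} (u : (Fin n → ℝ) → ℝ) (x : Fin n → ℝ) : Prop :=
  Filter.Tendsto (fun r : ℝ => ⨍ z in Metric.ball x r, u z)
    (nhdsWithin 0 (Set.Ioi 0)) (nhds (u x))

/-- Mollification. -/
noncomputable def moll {n : ℕ} (u φ : (Fin n → ℝ) → ℝ) (z : Fin n → ℝ) : ℝ :=
  ∫ w, u w * φ (z - w)

lemma moll_eq {n : ℕ} (u φ : (Fin n → ℝ) → ℝ) :
    moll u φ = MeasureTheory.convolution u φ (ContinuousLinearMap.mul ℝ ℝ) volume := by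
  funext z; rfl

lemma comp_supp {n : ℕ} {φ : (Fin n → ℝ) → ℝ} (hc : HasCompactSupport φ) (z : Fin n → ℝ) :
    HasCompactSupport (fun w => φ (z - w)) :=
  hc.comp_homeomorph (Homeomorph.subLeft z)

lemma moll_contDiff {n : ℕ} {u φ : (Fin n → ℝ) → ℝ} (hu : LocallyIntegrable u volume)
    (hφ : ContDiff ℝ (⊤ : ℕ∞) φ) (hc : HasCompactSupport φ) : ContDiff ℝ 1 (moll u φ) := by
  rw [moll_eq]
  exact hc.contDiff_convolution_right (n := 1) _ hu (hφ.of_le (by exact_mod_cast le_top))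

lemma moll_integrable {n : ℕ} {u φ : (Fin n → ℝ) → ℝ} (hu : LocallyIntegrable u volume)
    (hφ : Continuous φ) (hc : HasCompactSupport φ) (z : Fin n → ℝ) :
    Integrable (fun w => u w * φ (z - w)) volume := by
  have := hu.integrable_smul_right_of_hasCompactSupport
    (hφ.comp (continuous_const.sub continuous_id : Continuous fun w => z - w)) (comp_supp hc z)
  simpa using this

lemma moll_fderiv {n : ℕ} {u φ : (Fin n → ℝ) → ℝ} {g : (Fin n → ℝ) → (Fin n → ℝ)}
    (hu : LocallyIntegrable u volume) (hg : LocallyIntegrable g volume) (hw : IsWeakGrad u g)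
    (hφ : ContDiff ℝ (⊤ : ℕ∞) φ) (hc : HasCompactSupport φ) (z v : Fin n → ℝ) :
    fderiv ℝ (moll u φ) z v = ∫ w, (∑ i, v i * g w i) * φ (z - w) := by
  have h1 : ContDiff ℝ 1 φ := hφ.of_le (by exact_mod_cast le_top)
  have hd := hc.hasFDerivAt_convolution_right (ContinuousLinearMap.mul ℝ ℝ) hu h1 z
  have hgi : ∀ i, LocallyIntegrable (fun w => g w i) volume := by
    intro i x
    obtain ⟨s, hs, hi⟩ := hg x
    exact ⟨s, hs, (ContinuousLinearMap.proj (R := ℝ) (φ := fun _ : Fin n => ℝ) i).integrable_comp hi⟩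
  have hpart : ∀ i, fderiv ℝ (moll u φ) z (Pi.single i 1) = ∫ w, g w i * φ (z - w) := by
    intro i
    have := hw (fun w => φ (z - w)) (hφ.comp (contDiff_const.sub contDiff_id)) (comp_supp hc z) i
    have e : ∀ w, fderiv ℝ (fun w => φ (z - w)) w (Pi.single i 1)
        = - fderiv ℝ φ (z - w) (Pi.single i 1) := by
      intro w
      have : HasFDerivAt (fun w => φ (z - w)) ((fderiv ℝ φ (z - w)).comp (-(ContinuousLinearMap.id ℝ (Fin n → ℝ)))) w := by
        refine HasFDerivAt.comp w (h1.differentiable (by simp) _).hasFDerivAt ?_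
        exact (hasFDerivAt_id (𝕜 := ℝ) w).const_sub z
      rw [this.fderiv]; simp
    simp only [e, mul_neg, integral_neg, neg_inj] at this
    rw [← this, moll_eq, hd.fderiv, MeasureTheory.convolution]
    rw [ContinuousLinearMap.integral_apply]
    · rfl
    · exact (hc.fderiv ℝ).convolutionExists_right ((ContinuousLinearMap.mul ℝ ℝ).precompR (Fin n → ℝ)) hu
        (h1.continuous_fderiv (by simp)) z
  have hv : v = ∑ i, v i • (Pi.single i 1 : Fin n → ℝ) := by
    ext j; simp [Finset.sum_apply, Pi.single_apply]
  conv_lhs => rw [hv]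
  simp only [map_sum, map_smul, hpart, smul_eq_mul, Finset.sum_mul]
  rw [integral_finsetSum]
  · refine Finset.sum_congr rfl fun i _ => ?_
    rw [← integral_const_mul]; simp only [mul_assoc]
  · intro i _
    simpa only [mul_assoc] using (moll_integrable (hgi i) hφ.continuous hc z).const_mul (v i)

lemma ofReal_int_le {α : Type*} [MeasurableSpace α] {μ : Measure α} (f : α → ℝ) :
    ENNReal.ofReal (∫ x, f x ∂μ) ≤ ∫⁻ x, ENNReal.ofReal (f x) ∂μ := by
  by_cases hf : Integrable f μ
  · rw [integral_eq_lintegral_pos_part_sub_lintegral_neg_part hf]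
    refine (ENNReal.ofReal_le_ofReal (sub_le_self _ ENNReal.toReal_nonneg)).trans ?_
    exact ENNReal.ofReal_toReal_le
  · simp [integral_undef hf]

lemma ftc_bound {n : ℕ} {u φ : (Fin n → ℝ) → ℝ} {g : (Fin n → ℝ) → (Fin n → ℝ)}
    (hu : LocallyIntegrable u volume) (hg : LocallyIntegrable g volume) (hw : IsWeakGrad u g)
    (hφ : ContDiff ℝ (⊤ : ℕ∞) φ) (hc : HasCompactSupport φ) (h0 : ∀ x, 0 ≤ φ x)
    (h1 : ∀ x, φ x ≤ 1) {ρ : ℝ} (hs : ∀ x, ρ ≤ ‖x‖ → φ x = 0) (x z : Fin n → ℝ)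
    (k : (Fin n → ℝ) → ℝ≥0∞)
    (hk : ∀ᵐ w, ENNReal.ofReal (∑ i, (x i - z i) * g w i) ≤ k w) :
    ENNReal.ofReal (moll u φ x - moll u φ z) ≤
      ∫⁻ t in Set.Ioc (0 : ℝ) 1, ∫⁻ w in Metric.ball (x + t • (z - x)) ρ, k w := by
  have hC := moll_contDiff hu hφ hc
  have hder : ∀ t : ℝ, HasDerivAt (fun t : ℝ => - moll u φ (x + t • (z - x)))
      (- fderiv ℝ (moll u φ) (x + t • (z - x)) (z - x)) t := by
    intro t
    have hl : HasDerivAt (fun t : ℝ => x + t • (z - x)) (z - x) t := by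
      simpa using ((hasDerivAt_id t).smul_const (z - x)).const_add x
    exact ((hC.differentiable (by simp) _).hasFDerivAt.comp_hasDerivAt t hl).neg
  have hcont : Continuous fun t : ℝ => - fderiv ℝ (moll u φ) (x + t • (z - x)) (z - x) := by
    have := hC.continuous_fderiv (by simp)
    fun_prop
  have hftc := intervalIntegral.integral_eq_sub_of_hasDerivAt (a := 0) (b := 1)
    (fun t _ => hder t) (hcont.intervalIntegrable _ _)
  have e : moll u φ x - moll u φ z =
      ∫ t in Set.Ioc (0 : ℝ) 1, - fderiv ℝ (moll u φ) (x + t • (z - x)) (z - x) := by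
    rw [← intervalIntegral.integral_of_le zero_le_one, hftc]; simp; ring
  rw [e]
  refine (ofReal_int_le _).trans (lintegral_mono fun t => ?_)
  rw [moll_fderiv hu hg hw hφ hc, ← integral_neg]
  refine (ofReal_int_le _).trans ?_
  rw [← lintegral_indicator Metric.isOpen_ball.measurableSet]
  refine lintegral_mono_ae ?_
  filter_upwards [hk] with w hw
  by_cases hm : w ∈ Metric.ball (x + t • (z - x)) ρ
  · rw [Set.indicator_of_mem hm]
    refine le_trans ?_ hw
    have : -((∑ i, (z - x) i * g w i) * φ (x + t • (z - x) - w)) =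
      (∑ i, (x i - z i) * g w i) * φ (x + t • (z - x) - w) := by
      rw [← neg_mul, ← Finset.sum_neg_distrib]
      congr 1; refine Finset.sum_congr rfl fun i _ => ?_
      simp only [Pi.sub_apply]; ring
    rw [this, ENNReal.ofReal_mul' (h0 _)]
    exact mul_le_of_le_one_right' (by simpa using h1 _)
  · rw [Set.indicator_of_notMem hm, hs]
    · simp
    · rw [Metric.mem_ball, not_lt, dist_comm, dist_eq_norm] at hm
      exact hm

lemma rect_meas {n : ℕ} (x r : Fin n → ℝ) : MeasurableSet (rect x r) :=
  MeasurableSet.univ_pi fun _ => measurableSet_Ioo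

lemma rect_vol {n : ℕ} (x r : Fin n → ℝ) :
    volume (rect x r) = ∏ i, ENNReal.ofReal (2 * r i) := by
  rw [rect, volume_pi_pi]
  refine Finset.prod_congr rfl fun i _ => ?_
  rw [Real.volume_Ioo]; congr 1; ring

lemma geom_bound {n : ℕ} {k : (Fin n → ℝ) → ℝ≥0∞} (hk : Measurable k) (x s : Fin n → ℝ)
    (hs : ∀ i, 0 < s i) {L : ℝ≥0∞}
    (hL : ∀ q : Fin n → ℝ, (∀ i, 0 < q i) → ∫⁻ w in rect x q, k w ≤ L * volume (rect x q))
    {ρ : ℝ} (hρ : 0 < ρ) {t : ℝ} (ht : 0 < t) :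
    ∫⁻ z in rect x s, ∫⁻ w in Metric.ball (x + t • (z - x)) ρ, k w ≤
      L * ∏ i, ENNReal.ofReal (8 * s i * ρ) := by
  let S : Set ((Fin n → ℝ) × (Fin n → ℝ)) := {p | dist p.2 (x + t • (p.1 - x)) < ρ}
  have hS : MeasurableSet S := by
    apply IsOpen.measurableSet
    exact isOpen_lt (by fun_prop) continuous_const
  have e1 : ∀ z, ∫⁻ w in Metric.ball (x + t • (z - x)) ρ, k w =
      ∫⁻ w, S.indicator (fun p => k p.2) (z, w) := by
    intro z
    rw [← lintegral_indicator Metric.isOpen_ball.measurableSet]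
    rfl
  simp only [e1]
  rw [lintegral_lintegral_swap]
  swap
  · exact ((hk.comp measurable_snd).indicator hS).aemeasurable
  let m : Fin n → ℝ := fun i => min (2 * s i) (2 * (ρ / t))
  let q : Fin n → ℝ := fun i => t * s i + ρ
  have hq : ∀ i, 0 < q i := fun i => by have := hs i; positivity
  have key : ∀ w, ∫⁻ z in rect x s, S.indicator (fun p => k p.2) (z, w) ≤
      (rect x q).indicator (fun w => k w * ∏ i, ENNReal.ofReal (m i)) w := by
    intro w
    by_cases hw : w ∈ rect x q
    · rw [Set.indicator_of_mem hw]
      let T : Set (Fin n → ℝ) := Set.univ.pi fun i => Set.Ioo (x i - s i) (x i + s i) ∩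
        Set.Ioo (x i + (w i - x i) / t - ρ / t) (x i + (w i - x i) / t + ρ / t)
      have hT : MeasurableSet T := MeasurableSet.univ_pi fun _ =>
        measurableSet_Ioo.inter measurableSet_Ioo
      have hTv : volume T ≤ ∏ i, ENNReal.ofReal (m i) := by
        rw [volume_pi_pi]
        refine Finset.prod_le_prod' fun i _ => ?_
        simp only [m]
        rw [ENNReal.ofReal_min]
        refine le_min ((measure_mono Set.inter_subset_left).trans ?_)
          ((measure_mono Set.inter_subset_right).trans ?_)
        · rw [Real.volume_Ioo]; apply ENNReal.ofReal_le_ofReal; linarith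
        · rw [Real.volume_Ioo]; apply ENNReal.ofReal_le_ofReal; linarith
      calc ∫⁻ z in rect x s, S.indicator (fun p => k p.2) (z, w)
          ≤ ∫⁻ z, T.indicator (fun _ => k w) z := by
            rw [← lintegral_indicator (rect_meas x s)]
            refine lintegral_mono fun z => ?_
            by_cases h1 : z ∈ rect x s
            · rw [Set.indicator_of_mem h1]
              by_cases h2 : (z, w) ∈ S
              · have h3 : z ∈ T := by
                  intro i _
                  refine ⟨h1 i trivial, ?_⟩
                  have h4 := (dist_pi_lt_iff hρ).1 h2 i
                  rw [Real.dist_eq, abs_lt] at h4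
                  simp only [Pi.add_apply, Pi.smul_apply, Pi.sub_apply, smul_eq_mul] at h4
                  have e2 : x i + (w i - x i) / t - ρ / t = x i + (w i - x i - ρ) / t := by ring
                  have e3 : x i + (w i - x i) / t + ρ / t = x i + (w i - x i + ρ) / t := by ring
                  have h5 : (w i - x i - ρ) / t < z i - x i := by
                    rw [div_lt_iff₀ ht]; nlinarith [h4.1, h4.2]
                  have h6 : z i - x i < (w i - x i + ρ) / t := by
                    rw [lt_div_iff₀ ht]; nlinarith [h4.1, h4.2]
                  rw [e2, e3]
                  constructor <;> linarith
                rw [Set.indicator_of_mem h3, Set.indicator_of_mem h2]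
              · rw [Set.indicator_of_notMem h2]; exact zero_le
            · rw [Set.indicator_of_notMem h1]; exact zero_le
        _ = k w * volume T := by rw [lintegral_indicator hT, setLIntegral_const]
        _ ≤ _ := by gcongr
    · rw [Set.indicator_of_notMem hw, nonpos_iff_eq_zero]
      rw [← lintegral_indicator (rect_meas x s)]
      rw [← lintegral_zero (μ := (volume : Measure (Fin n → ℝ)))]
      refine lintegral_congr fun z => ?_
      by_cases h1 : z ∈ rect x s
      · rw [Set.indicator_of_mem h1, Set.indicator_of_notMem]
        · intro h2
          apply hw
          intro i _
          have h4 := (dist_pi_lt_iff hρ).1 h2 i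
          rw [Real.dist_eq, abs_lt] at h4
          simp only [Pi.add_apply, Pi.smul_apply, Pi.sub_apply, smul_eq_mul] at h4
          have h7 := h1 i trivial
          have h8 : t * (z i - x i) < t * s i := by
            apply mul_lt_mul_of_pos_left _ ht; linarith [h7.2]
          have h9 : t * (-s i) < t * (z i - x i) := by
            apply mul_lt_mul_of_pos_left _ ht; linarith [h7.1]
          simp only [q]
          constructor <;> linarith [h4.1, h4.2]
      · rw [Set.indicator_of_notMem h1]
  refine (lintegral_mono key).trans ?_
  rw [lintegral_indicator (rect_meas x q), lintegral_mul_const _ hk]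
  calc _ ≤ (L * volume (rect x q)) * ∏ i, ENNReal.ofReal (m i) := by gcongr; exact hL q hq
    _ ≤ _ := by
      rw [mul_assoc, rect_vol, ← Finset.prod_mul_distrib]
      gcongr with i
      rw [← ENNReal.ofReal_mul (by have := hq i; positivity)]
      apply ENNReal.ofReal_le_ofReal
      simp only [q, m]
      have h1 : min (2 * s i) (2 * (ρ / t)) ≤ 2 * s i := min_le_left _ _
      have h2 : min (2 * s i) (2 * (ρ / t)) ≤ 2 * (ρ / t) := min_le_right _ _
      have h3 : t * s i * min (2 * s i) (2 * (ρ / t)) ≤ t * s i * (2 * (ρ / t)) := by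
        have := hs i; gcongr
      have h4 : t * s i * (2 * (ρ / t)) = 2 * s i * ρ := by field_simp
      nlinarith [mul_le_mul_of_nonneg_left h1 hρ.le]

lemma core {n : ℕ} {u φ : (Fin n → ℝ) → ℝ} {g : (Fin n → ℝ) → (Fin n → ℝ)}
    (hu : LocallyIntegrable u volume) (hg : LocallyIntegrable g volume) (hw : IsWeakGrad u g)
    (hφ : ContDiff ℝ (⊤ : ℕ∞) φ) (hc : HasCompactSupport φ) (h0 : ∀ x, 0 ≤ φ x)
    (h1 : ∀ x, φ x ≤ 1) {ρ : ℝ} (hρ : 0 < ρ) (hs : ∀ x, ρ ≤ ‖x‖ → φ x = 0)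
    {x c : Fin n → ℝ} {lam mu : ℝ} (hl : 0 < lam) (hm : 0 < mu)
    (hx1 : strongMax (fun w => ‖fun i => max (g w i) 0‖) x ≤ ENNReal.ofReal lam)
    (hx2 : strongMax (fun w => ‖fun i => max (-(g w i)) 0‖) x ≤ ENNReal.ofReal mu)
    {ε : ℝ} (hε : 0 < ε) {Z : Set (Fin n → ℝ)}
    (hZs : Z ⊆ rect c (fun i => |x i - c i| + ε)) :
    ∫⁻ z in Z, ENNReal.ofReal (moll u φ x - moll u φ z) ≤
      ENNReal.ofReal (lam * (∑ i, (2 * max (x i - c i) 0 + ε)) +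
        mu * (∑ i, (2 * max (c i - x i) 0 + ε))) *
      (volume (rect c (fun i => |x i - c i| + ε)) * ENNReal.ofReal (8 * ρ) ^ n) := by
  set a := ∑ i, (2 * max (x i - c i) 0 + ε) with ha
  set b := ∑ i, (2 * max (c i - x i) 0 + ε) with hb
  have ha0 : 0 ≤ a := Finset.sum_nonneg fun i _ => by positivity
  have hb0 : 0 ≤ b := Finset.sum_nonneg fun i _ => by positivity
  let p : (Fin n → ℝ) → ℝ := fun w => ‖fun i => max (g w i) 0‖
  let q : (Fin n → ℝ) → ℝ := fun w => ‖fun i => max (-(g w i)) 0‖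
  have hgm := hg.aestronglyMeasurable.aemeasurable
  have hpm : AEMeasurable p volume := by
    have : Continuous fun v : Fin n → ℝ => ‖fun i => max (v i) 0‖ := by fun_prop
    exact this.measurable.comp_aemeasurable hgm
  have hqm : AEMeasurable q volume := by
    have : Continuous fun v : Fin n → ℝ => ‖fun i => max (-(v i)) 0‖ := by fun_prop
    exact this.measurable.comp_aemeasurable hgm
  have hk0 : AEMeasurable (fun w => ENNReal.ofReal a * ENNReal.ofReal (p w) +
    ENNReal.ofReal b * ENNReal.ofReal (q w)) volume :=
    (hpm.ennreal_ofReal.const_mul _).add (hqm.ennreal_ofReal.const_mul _)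
  let k := hk0.mk
  have hkm : Measurable k := hk0.measurable_mk
  have hke := hk0.ae_eq_mk
  let s : Fin n → ℝ := fun i => 2 * (|x i - c i| + ε)
  have hs0 : ∀ i, 0 < s i := fun i => by positivity
  have hmax : ∀ (f : (Fin n → ℝ) → ℝ) (M : ℝ), (∀ w, 0 ≤ f w) →
      strongMax f x ≤ ENNReal.ofReal M → ∀ r : Fin n → ℝ, (∀ i, 0 < r i) →
      ∫⁻ w in rect x r, ENNReal.ofReal (f w) ≤ ENNReal.ofReal M * volume (rect x r) := by
    intro f M hf h r hr
    have := (le_iSup (fun r : {r : Fin n → ℝ // ∀ i, 0 < r i} =>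
      (∫⁻ z in rect x (r : Fin n → ℝ), ENNReal.ofReal |f z|) /
        volume (rect x (r : Fin n → ℝ))) ⟨r, hr⟩).trans h
    simp only [abs_of_nonneg (hf _)] at this
    rwa [ENNReal.div_le_iff] at this
    · rw [rect_vol]
      simp only [ne_eq, Finset.prod_eq_zero_iff, not_exists, not_and, ENNReal.ofReal_eq_zero, not_le]
      intro i _; have := hr i; positivity
    · rw [rect_vol]; exact ENNReal.prod_ne_top fun i _ => ENNReal.ofReal_ne_top
  have hL : ∀ r : Fin n → ℝ, (∀ i, 0 < r i) → ∫⁻ w in rect x r, k w ≤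
      ENNReal.ofReal (lam * a + mu * b) * volume (rect x r) := by
    intro r hr
    rw [← lintegral_congr_ae (ae_restrict_of_ae hke)]
    rw [lintegral_add_left' (hpm.ennreal_ofReal.const_mul _).restrict,
      lintegral_const_mul'' _ hpm.ennreal_ofReal.restrict,
      lintegral_const_mul'' _ hqm.ennreal_ofReal.restrict]
    rw [ENNReal.ofReal_add (by positivity) (by positivity), ENNReal.ofReal_mul hl.le,
      ENNReal.ofReal_mul hm.le, add_mul]
    refine add_le_add ?_ ?_
    · rw [mul_comm (ENNReal.ofReal lam), mul_assoc]
      gcongr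
      exact hmax p lam (fun w => norm_nonneg _) hx1 r hr
    · rw [mul_comm (ENNReal.ofReal mu), mul_assoc]
      gcongr
      exact hmax q mu (fun w => norm_nonneg _) hx2 r hr
  have hzb : ∀ z ∈ rect c (fun i => |x i - c i| + ε), ∀ i,
      max (x i - z i) 0 ≤ 2 * max (x i - c i) 0 + ε ∧
      max (-(x i - z i)) 0 ≤ 2 * max (c i - x i) 0 + ε := by
    intro z hz i
    have h := hz i trivial
    simp only [Set.mem_Ioo] at h
    rcases le_total 0 (x i - c i) with h' | h'
    · rw [abs_of_nonneg h'] at h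
      rw [max_eq_left h', max_eq_right (by linarith : c i - x i ≤ 0)]
      constructor <;> apply max_le <;> linarith
    · rw [abs_of_nonpos h'] at h
      rw [max_eq_right h', max_eq_left (by linarith : 0 ≤ c i - x i)]
      constructor <;> apply max_le <;> linarith
  have hkz : ∀ z ∈ rect c (fun i => |x i - c i| + ε),
      ∀ᵐ w, ENNReal.ofReal (∑ i, (x i - z i) * g w i) ≤ k w := by
    intro z hz
    filter_upwards [hke] with w hw
    change _ = k w at hw
    rw [← hw, ← ENNReal.ofReal_mul ha0, ← ENNReal.ofReal_mul hb0,
      ← ENNReal.ofReal_add (mul_nonneg ha0 (norm_nonneg _)) (mul_nonneg hb0 (norm_nonneg _))]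
    apply ENNReal.ofReal_le_ofReal
    rw [ha, hb, Finset.sum_mul, Finset.sum_mul, ← Finset.sum_add_distrib]
    refine Finset.sum_le_sum fun i _ => ?_
    obtain ⟨h1, h2⟩ := hzb z hz i
    have hp : max (g w i) 0 ≤ p w := (le_abs_self _).trans
      (norm_le_pi_norm (fun i => max (g w i) 0) i)
    have hq : max (-(g w i)) 0 ≤ q w := (le_abs_self _).trans
      (norm_le_pi_norm (fun i => max (-(g w i)) 0) i)
    have h3 := mul_le_mul h1 hp (le_max_right _ _) (by positivity)
    have h4 := mul_le_mul h2 hq (le_max_right _ _) (by positivity)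
    refine le_trans ?_ (add_le_add h3 h4)
    rcases le_total 0 (x i - z i) with h | h <;> rcases le_total 0 (g w i) with h' | h'
    · simp [h, h']
    · rw [max_eq_right h', max_eq_right (by linarith : -(x i - z i) ≤ 0)]
      nlinarith
    · rw [max_eq_right h, max_eq_right (by linarith : -(g w i) ≤ 0)]
      nlinarith
    · rw [max_eq_right h, max_eq_right h', max_eq_left (by linarith : 0 ≤ -(x i - z i)),
        max_eq_left (by linarith : 0 ≤ -(g w i))]
      nlinarith
  have hsub : rect c (fun i => |x i - c i| + ε) ⊆ rect x s := by
    intro z hz i _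
    have h := hz i trivial
    simp only [Set.mem_Ioo, s] at h ⊢
    constructor <;> cases abs_cases (x i - c i) <;> linarith
  let S : Set (((Fin n → ℝ) × ℝ) × (Fin n → ℝ)) := {p | dist p.2 (x + p.1.2 • (p.1.1 - x)) < ρ}
  have hS : MeasurableSet S := by
    apply IsOpen.measurableSet
    exact isOpen_lt (by fun_prop) continuous_const
  have e1 : ∀ z t, ∫⁻ w in Metric.ball (x + t • (z - x)) ρ, k w =
      ∫⁻ w, S.indicator (fun p => k p.2) ((z, t), w) := by
    intro z t
    rw [← lintegral_indicator Metric.isOpen_ball.measurableSet]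
    rfl
  have hjm : Measurable fun p : (Fin n → ℝ) × ℝ =>
      ∫⁻ w in Metric.ball (x + p.2 • (p.1 - x)) ρ, k w := by
    simp only [e1]
    exact ((hkm.comp measurable_snd).indicator hS).lintegral_prod_right'
  calc ∫⁻ z in Z, ENNReal.ofReal (moll u φ x - moll u φ z)
      ≤ ∫⁻ z in rect c (fun i => |x i - c i| + ε), ENNReal.ofReal (moll u φ x - moll u φ z) :=
        lintegral_mono_set hZs
    _ ≤ ∫⁻ z in rect c (fun i => |x i - c i| + ε),
        ∫⁻ t in Set.Ioc (0 : ℝ) 1, ∫⁻ w in Metric.ball (x + t • (z - x)) ρ, k w :=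
        setLIntegral_mono' (rect_meas _ _) fun z hz =>
          ftc_bound hu hg hw hφ hc h0 h1 hs x z k (hkz z hz)
    _ ≤ ∫⁻ z in rect x s,
        ∫⁻ t in Set.Ioc (0 : ℝ) 1, ∫⁻ w in Metric.ball (x + t • (z - x)) ρ, k w :=
        lintegral_mono_set hsub
    _ = ∫⁻ t in Set.Ioc (0 : ℝ) 1, ∫⁻ z in rect x s,
          ∫⁻ w in Metric.ball (x + t • (z - x)) ρ, k w :=
        lintegral_lintegral_swap hjm.aemeasurable
    _ ≤ ∫⁻ t in Set.Ioc (0 : ℝ) 1, ENNReal.ofReal (lam * a + mu * b) *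
          ∏ i, ENNReal.ofReal (8 * s i * ρ) :=
        setLIntegral_mono' measurableSet_Ioc fun t ht => geom_bound hkm x s hs0 hL hρ ht.1
    _ = _ := by
        rw [setLIntegral_const, Real.volume_Ioc, rect_vol]
        simp only [sub_zero, ENNReal.ofReal_one, mul_one]
        congr 1
        rw [← Fin.prod_const, ← Finset.prod_mul_distrib]
        refine Finset.prod_congr rfl fun i _ => ?_
        rw [← ENNReal.ofReal_mul (by positivity)]
        congr 1; simp only [s]; ring

/-- Admissible mollifiers at scale `ρ`. -/
def Good {n : ℕ} (ρ : ℝ) (φ : (Fin n → ℝ) → ℝ) : Prop :=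
  ContDiff ℝ (⊤ : ℕ∞) φ ∧ HasCompactSupport φ ∧ (∀ x, 0 ≤ φ x) ∧ (∀ x, φ x ≤ 1) ∧
    (∀ x, ρ ≤ ‖x‖ → φ x = 0)

/-- The error bound. -/
noncomputable def TT {n : ℕ} (lam mu ε : ℝ) (x c : Fin n → ℝ) : ℝ :=
  lam * (∑ i, (2 * max (x i - c i) 0 + ε)) + mu * (∑ i, (2 * max (c i - x i) 0 + ε))

lemma TT_nonneg {n : ℕ} {lam mu ε : ℝ} (hl : 0 < lam) (hm : 0 < mu) (hε : 0 < ε)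
    (x c : Fin n → ℝ) : 0 ≤ TT lam mu ε x c := by
  unfold TT; positivity

lemma exists_good (n : ℕ) {ρ : ℝ} (hρ : 0 < ρ) : ∃ φ : ℕ → (Fin n → ℝ) → ℝ,
    (∀ j, Good ρ (φ j)) ∧ ∀ u : (Fin n → ℝ) → ℝ, LocallyIntegrable u volume → ∀ z,
      Filter.Tendsto (fun j => moll u (φ j) z) Filter.atTop
        (nhds (∫ w in Metric.ball z ρ, u w)) := by
  have hpos : ∀ j : ℕ, 0 < ρ * (1 - 1 / ((j : ℝ) + 2)) := by
    intro j
    have : 1 / ((j : ℝ) + 2) < 1 := by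
      rw [div_lt_one (by positivity)]; have : (0 : ℝ) ≤ j := by positivity
      linarith
    apply mul_pos hρ; linarith
  have hlt : ∀ j : ℕ, ρ * (1 - 1 / ((j : ℝ) + 2)) < ρ := by
    intro j
    have : 0 < 1 / ((j : ℝ) + 2) := by positivity
    nlinarith
  let f : ℕ → ContDiffBump (0 : Fin n → ℝ) := fun j => ⟨_, ρ, hpos j, hlt j⟩
  have hg : ∀ j, Good ρ (f j) := fun j =>
    ⟨(f j).contDiff, (f j).hasCompactSupport, (f j).nonneg', fun _ => (f j).le_one, fun x hx =>
      (f j).zero_of_le_dist (by simpa using hx)⟩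
  refine ⟨fun j => f j, hg, fun u hu z => ?_⟩
  rw [← integral_indicator Metric.isOpen_ball.measurableSet]
  refine tendsto_integral_of_dominated_convergence
    (fun w => (Metric.closedBall z ρ).indicator (fun w => ‖u w‖) w) ?_ ?_ ?_ ?_
  · intro j
    exact (moll_integrable hu (f j).continuous (f j).hasCompactSupport z).aestronglyMeasurable
  · have hi : IntegrableOn (fun w => ‖u w‖) (Metric.closedBall z ρ) volume :=
      (hu.integrableOn_isCompact (isCompact_closedBall z ρ)).norm
    exact hi.integrable_indicator Metric.isClosed_closedBall.measurableSet
  · intro j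
    refine Filter.Eventually.of_forall fun w => ?_
    by_cases hw : w ∈ Metric.closedBall z ρ
    · rw [Set.indicator_of_mem hw, norm_mul]
      apply mul_le_of_le_one_right (norm_nonneg _)
      rw [Real.norm_of_nonneg ((hg j).2.2.1 _)]
      exact (hg j).2.2.2.1 _
    · rw [Set.indicator_of_notMem hw]
      beta_reduce
      rw [(hg j).2.2.2.2]
      · simp
      · rw [Metric.mem_closedBall, not_le, dist_comm, dist_eq_norm] at hw
        exact hw.le
  · refine Filter.Eventually.of_forall fun w => ?_
    by_cases hw : w ∈ Metric.ball z ρ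
    · rw [Set.indicator_of_mem hw]
      have hlim : Filter.Tendsto (fun j : ℕ => ρ * (1 - 1 / ((j : ℝ) + 2))) Filter.atTop
          (nhds ρ) := by
        have h1 : Filter.Tendsto (fun j : ℕ => (j : ℝ) + 2) Filter.atTop Filter.atTop :=
          Filter.tendsto_atTop_add_const_right _ _ tendsto_natCast_atTop_atTop
        have h2 := (h1.inv_tendsto_atTop.const_sub 1).const_mul ρ
        simpa using h2
      rw [Metric.mem_ball, dist_comm, dist_eq_norm] at hw
      refine tendsto_const_nhds.congr' ?_
      filter_upwards [hlim.eventually (lt_mem_nhds hw)] with j hj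
      rw [(f j).one_of_mem_closedBall, mul_one]
      rw [mem_closedBall_zero_iff]
      exact hj.le
    · rw [Set.indicator_of_notMem hw]
      refine tendsto_const_nhds.congr fun j => ?_
      beta_reduce
      rw [(hg j).2.2.2.2, mul_zero]
      rw [Metric.mem_ball, not_lt, dist_comm, dist_eq_norm] at hw
      exact hw

lemma leb_limit {n : ℕ} {u : (Fin n → ℝ) → ℝ} (hu : LocallyIntegrable u volume)
    {x y : Fin n → ℝ} (hx : LebPoint u x) (hy : LebPoint u y) (α β K : ℝ) {ρ₀ : ℝ} (h0 : 0 < ρ₀)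
    (h : ∀ ρ, 0 < ρ → ρ < ρ₀ → ∀ φ, Good ρ φ →
      α * moll u φ x + β * moll u φ y ≤ K * (8 * ρ) ^ n) :
    α * u x + β * u y ≤ K * 4 ^ n := by
  refine le_of_tendsto ((hx.const_mul α).add (hy.const_mul β)) ?_
  filter_upwards [Ioo_mem_nhdsGT h0] with ρ hρ
  obtain ⟨φ, hφ, hlim⟩ := exists_good n hρ.1
  have h1 := le_of_tendsto (((hlim u hu x).const_mul α).add ((hlim u hu y).const_mul β))
    (Filter.Eventually.of_forall fun j => h ρ hρ.1 hρ.2 (φ j) (hφ j))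
  have hv : ∀ z : Fin n → ℝ, volume.real (Metric.ball z ρ) = (2 * ρ) ^ n := by
    intro z
    rw [measureReal_def, Real.volume_pi_ball z hρ.1, Fintype.card_fin,
      ENNReal.toReal_ofReal (by have := hρ.1; positivity)]
  have hp : 0 < (2 * ρ) ^ n := by have := hρ.1; positivity
  rw [setAverage_eq, setAverage_eq, hv, hv, smul_eq_mul, smul_eq_mul]
  have e : (8 * ρ) ^ n = 4 ^ n * (2 * ρ) ^ n := by rw [← mul_pow]; congr 1; ring
  rw [e] at h1
  have : α * (((2 * ρ) ^ n)⁻¹ * ∫ z in Metric.ball x ρ, u z) +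
      β * (((2 * ρ) ^ n)⁻¹ * ∫ z in Metric.ball y ρ, u z) =
      (α * (∫ z in Metric.ball x ρ, u z) + β * (∫ z in Metric.ball y ρ, u z)) / (2 * ρ) ^ n := by
    field_simp
  rw [this, div_le_iff₀ hp]
  linarith

lemma weak_neg {n : ℕ} {u : (Fin n → ℝ) → ℝ} {g : (Fin n → ℝ) → (Fin n → ℝ)}
    (hw : IsWeakGrad u g) : IsWeakGrad (-u) (-g) := by
  intro φ h1 h2 i
  have := hw φ h1 h2 i
  simp only [Pi.neg_apply, neg_mul, integral_neg]
  rw [this]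

lemma leb_neg {n : ℕ} {u : (Fin n → ℝ) → ℝ} {x : Fin n → ℝ}
    (hx : LebPoint u x) : LebPoint (-u) x := by
  have := hx.neg
  unfold LebPoint
  simpa only [Pi.neg_apply, average_neg] using this

lemma moll_neg {n : ℕ} (u φ : (Fin n → ℝ) → ℝ) (x : Fin n → ℝ) :
    moll (-u) φ x = - moll u φ x := by
  simp [moll, integral_neg]

lemma dAs_eq (l m t : ℝ) : dAs l m t = l * max t 0 + m * max (-t) 0 := by
  unfold dAs
  split_ifs with h
  · rw [max_eq_left h, max_eq_right (by linarith)]; ring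
  · push Not at h
    rw [max_eq_right h.le, max_eq_left (by linarith)]; ring

lemma dAsV_eq {n : ℕ} (l m : ℝ) (x y : Fin n → ℝ) :
    dAsV l m x y = l * (∑ i, max (x i - y i) 0) + m * ∑ i, max (y i - x i) 0 := by
  unfold dAsV
  simp only [dAs_eq, Finset.sum_add_distrib, Finset.mul_sum, neg_sub]

lemma dAsV_nonneg {n : ℕ} {l m : ℝ} (hl : 0 ≤ l) (hm : 0 ≤ m) (x y : Fin n → ℝ) :
    0 ≤ dAsV l m x y := by
  rw [dAsV_eq]; positivity

lemma dAsV_swap {n : ℕ} (l m : ℝ) (x y : Fin n → ℝ) : dAsV l m x y = dAsV m l y x := by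
  rw [dAsV_eq, dAsV_eq]; ring

lemma TT_limit {n : ℕ} {lam mu K A : ℝ} {x c : Fin n → ℝ}
    (h : ∀ ε, 0 < ε → A ≤ K * TT lam mu ε x c) :
    A ≤ K * dAsV (2 * lam) (2 * mu) x c := by
  have hc : Continuous fun ε => K * TT lam mu ε x c := by unfold TT; fun_prop
  have e : K * dAsV (2 * lam) (2 * mu) x c = K * TT lam mu 0 x c := by
    rw [dAsV_eq, TT]
    simp only [add_zero, ← Finset.mul_sum]; ring
  rw [e]
  have ht : Filter.Tendsto (fun ε => K * TT lam mu ε x c) (nhdsWithin (0 : ℝ) (Set.Ioi 0))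
      (nhds (K * TT lam mu 0 x c)) := (hc.tendsto 0).mono_left nhdsWithin_le_nhds
  refine ge_of_tendsto ht ?_
  filter_upwards [self_mem_nhdsWithin] with ε hε using h ε hε

lemma rect_vol_ne {n : ℕ} {x r : Fin n → ℝ} (hr : ∀ i, 0 < r i) :
    volume (rect x r) ≠ 0 ∧ volume (rect x r) ≠ ∞ := by
  constructor
  · rw [rect_vol]
    simp only [ne_eq, Finset.prod_eq_zero_iff, not_exists, not_and, ENNReal.ofReal_eq_zero, not_le]
    intro i _; have := hr i; positivity
  · rw [rect_vol]; exact ENNReal.prod_ne_top fun i _ => ENNReal.ofReal_ne_top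

lemma ofReal_split {T ρ : ℝ} {n : ℕ} (hT : 0 ≤ T) (hρ : 0 ≤ ρ) :
    ENNReal.ofReal (2 * T * (8 * ρ) ^ n) =
      2 * ENNReal.ofReal T * ENNReal.ofReal (8 * ρ) ^ n := by
  rw [ENNReal.ofReal_mul (by positivity), ENNReal.ofReal_mul (by positivity),
    ENNReal.ofReal_pow (by positivity), ENNReal.ofReal_ofNat]

lemma interior_case {n : ℕ} {u : (Fin n → ℝ) → ℝ} {g : (Fin n → ℝ) → (Fin n → ℝ)}
    (hu : LocallyIntegrable u volume) (hg : LocallyIntegrable g volume) (hw : IsWeakGrad u g)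
    {x y : Fin n → ℝ} {lam mu : ℝ} (hl : 0 < lam) (hm : 0 < mu)
    (hx1 : strongMax (fun w => ‖fun i => max (g w i) 0‖) x ≤ ENNReal.ofReal lam)
    (hx2 : strongMax (fun w => ‖fun i => max (-(g w i)) 0‖) x ≤ ENNReal.ofReal mu)
    (hy1 : strongMax (fun w => ‖fun i => max (g w i) 0‖) y ≤ ENNReal.ofReal lam)
    (hy2 : strongMax (fun w => ‖fun i => max (-(g w i)) 0‖) y ≤ ENNReal.ofReal mu)
    (hx : LebPoint u x) (hy : LebPoint u y) :
    u x - u y ≤ dAsV (4 * 4 ^ n * lam) (4 * 4 ^ n * mu) x y := by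
  set c : Fin n → ℝ := fun i => (x i + y i) / 2 with hc
  have key : ∀ ε, 0 < ε → u x - u y ≤ (2 * 4 ^ n) * TT lam mu ε x c := by
    intro ε hε
    have hT := TT_nonneg hl hm hε x c
    have := leb_limit hu hx hy 1 (-1) (2 * TT lam mu ε x c) one_pos ?_
    · linarith
    intro ρ hρ _ φ ⟨f1, f2, f3, f4, f5⟩
    have h1 := core hu hg hw f1 f2 f3 f4 hρ f5 (c := c) hl hm hx1 hx2 hε subset_rfl
    have h2 := core hu.neg hg.neg (weak_neg hw) f1 f2 f3 f4 hρ f5 (c := c) (x := y) hm hl hy2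
      (by simpa using hy1) hε subset_rfl
    have hr : (fun i => |y i - c i| + ε) = fun i => |x i - c i| + ε := by
      funext i
      rw [abs_sub_comm]; congr 2; simp only [hc]; ring
    have hT2 : TT mu lam ε y c = TT lam mu ε x c := by
      unfold TT
      have e1 : ∀ i, x i - c i = c i - y i := fun i => by simp only [hc]; ring
      have e2 : ∀ i, c i - x i = y i - c i := fun i => by simp only [hc]; ring
      simp only [e1, e2]; ring
    rw [hr] at h2
    change _ ≤ ENNReal.ofReal (TT lam mu ε x c) * _ at h1
    change _ ≤ ENNReal.ofReal (TT mu lam ε y c) * _ at h2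
    rw [hT2] at h2
    simp only [moll_neg] at h2
    set R := rect c fun i => |x i - c i| + ε with hR
    obtain ⟨hv0, hvt⟩ := rect_vol_ne (x := c) (r := fun i => |x i - c i| + ε)
      (fun i => by positivity)
    have hcm := (moll_contDiff hu f1 f2).continuous
    have h3 : ENNReal.ofReal (moll u φ x - moll u φ y) * volume R ≤
        (ENNReal.ofReal (2 * TT lam mu ε x c * (8 * ρ) ^ n)) * volume R := by
      calc ENNReal.ofReal (moll u φ x - moll u φ y) * volume R
          = ∫⁻ z in R, ENNReal.ofReal (moll u φ x - moll u φ y) := by rw [setLIntegral_const]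
        _ ≤ ∫⁻ z in R, (ENNReal.ofReal (moll u φ x - moll u φ z) +
              ENNReal.ofReal (-moll u φ y - -moll u φ z)) := by
            refine lintegral_mono fun z => ?_
            refine le_trans (ENNReal.ofReal_le_ofReal ?_) ENNReal.ofReal_add_le
            linarith
        _ = (∫⁻ z in R, ENNReal.ofReal (moll u φ x - moll u φ z)) +
              ∫⁻ z in R, ENNReal.ofReal (-moll u φ y - -moll u φ z) := by
            rw [lintegral_add_left]
            exact (continuous_const.sub hcm).measurable.ennreal_ofReal
        _ ≤ _ := add_le_add h1 h2
        _ = _ := by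
            rw [ofReal_split hT hρ.le]; ring
    have h4 := (ENNReal.mul_le_mul_iff_left hv0 hvt).1 h3
    have h5 := (ENNReal.ofReal_le_ofReal_iff (by positivity)).1 h4
    linarith
  have := TT_limit key
  refine this.trans ?_
  rw [dAsV_eq, dAsV_eq]
  have e1 : ∀ i, max (x i - c i) 0 = (1 / 2) * max (x i - y i) 0 := fun i => by
    rw [mul_max_of_nonneg _ _ (by norm_num)]; simp only [hc]; congr 1 <;> ring
  have e2 : ∀ i, max (c i - x i) 0 = (1 / 2) * max (y i - x i) 0 := fun i => by
    rw [mul_max_of_nonneg _ _ (by norm_num)]; simp only [hc]; congr 1 <;> ring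
  simp only [e1, e2, ← Finset.mul_sum]
  have hS1 : 0 ≤ 4 ^ n * (lam * ∑ i, max (x i - y i) 0) := by positivity
  have hS2 : 0 ≤ 4 ^ n * (mu * ∑ i, max (y i - x i) 0) := by positivity
  linarith

lemma outer_case {n : ℕ} {Ω : Set (Fin n → ℝ)} (hΩ : Convex ℝ Ω)
    {u : (Fin n → ℝ) → ℝ} {g : (Fin n → ℝ) → (Fin n → ℝ)}
    (hu : LocallyIntegrable u volume) (hg : LocallyIntegrable g volume) (hw : IsWeakGrad u g)
    (hz : ∀ x, x ∉ Ω → u x = 0)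
    {x y : Fin n → ℝ} {lam mu : ℝ} (hl : 0 < lam) (hm : 0 < mu)
    (hx1 : strongMax (fun w => ‖fun i => max (g w i) 0‖) x ≤ ENNReal.ofReal lam)
    (hx2 : strongMax (fun w => ‖fun i => max (-(g w i)) 0‖) x ≤ ENNReal.ofReal mu)
    (hx : LebPoint u x) (hy : y ∉ closure Ω) :
    u x ≤ dAsV (4 * 4 ^ n * lam) (4 * 4 ^ n * mu) x y := by
  have key : ∀ ε, 0 < ε → u x ≤ (2 * 4 ^ n) * TT lam mu ε x y := by
    intro ε hε
    have hT := TT_nonneg hl hm hε x y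
    obtain ⟨ρ₀, hρ₀, hball⟩ := Metric.isOpen_iff.1 isClosed_closure.isOpen_compl y hy
    have := leb_limit hu hx hx 1 0 (2 * TT lam mu ε x y) hρ₀ ?_
    · linarith
    intro ρ hρ hρlt φ ⟨f1, f2, f3, f4, f5⟩
    set R := rect y fun i => |x i - y i| + ε with hR
    set Z := R \ Metric.thickening ρ Ω with hZ
    have hZm : MeasurableSet Z :=
      (rect_meas _ _).diff Metric.isOpen_thickening.measurableSet
    have h1 := core hu hg hw f1 f2 f3 f4 hρ f5 (c := y) hl hm hx1 hx2 hε
      (Set.sdiff_subset : Z ⊆ R)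
    change _ ≤ ENNReal.ofReal (TT lam mu ε x y) * _ at h1
    obtain ⟨hv0, hvt⟩ := rect_vol_ne (x := y) (r := fun i => |x i - y i| + ε)
      (fun i => by positivity)
    have hzero : ∀ z ∈ Z, moll u φ z = 0 := by
      intro z hzZ
      unfold moll
      rw [← integral_zero (Fin n → ℝ) ℝ (μ := volume)]
      congr 1; funext w
      by_cases hwΩ : w ∈ Ω
      · rw [f5, mul_zero]
        by_contra hlt
        push Not at hlt
        apply hzZ.2
        rw [Metric.mem_thickening_iff]
        exact ⟨w, hwΩ, by rwa [dist_eq_norm]⟩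
      · rw [hz w hwΩ, zero_mul]
    have hrefl : R ⊆ Z ∪ (fun z => (2 : ℝ) • y - z) ⁻¹' Z := by
      intro z hzR
      by_contra hcon
      rw [Set.mem_union, not_or] at hcon
      have hzR' : (2 : ℝ) • y - z ∈ R := by
        intro i _
        have := hzR i trivial
        simp only [Set.mem_Ioo, Pi.sub_apply, Pi.smul_apply, smul_eq_mul] at this ⊢
        constructor <;> linarith [this.1, this.2]
      have ha : z ∈ Metric.thickening ρ Ω := by
        by_contra h; exact hcon.1 ⟨hzR, h⟩
      have hb : (2 : ℝ) • y - z ∈ Metric.thickening ρ Ω := by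
        by_contra h; exact hcon.2 ⟨hzR', h⟩
      have hmid := (hΩ.thickening ρ) ha hb (by norm_num : (0 : ℝ) ≤ 1 / 2)
        (by norm_num : (0 : ℝ) ≤ 1 / 2) (by norm_num)
      have e : (1 / 2 : ℝ) • z + (1 / 2 : ℝ) • ((2 : ℝ) • y - z) = y := by
        rw [smul_sub, smul_smul]; norm_num
      rw [e, Metric.mem_thickening_iff] at hmid
      obtain ⟨w, hwΩ, hd⟩ := hmid
      refine hball (?_ : w ∈ Metric.ball y ρ₀) (subset_closure hwΩ)
      rw [Metric.mem_ball, dist_comm]; linarith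
    have hvol : volume R ≤ 2 * volume Z := by
      refine (measure_mono hrefl).trans ((measure_union_le _ _).trans ?_)
      rw [(Measure.measurePreserving_sub_left volume ((2 : ℝ) • y)).measure_preimage
        hZm.nullMeasurableSet, two_mul]
    have h3 : ENNReal.ofReal (moll u φ x) * volume R ≤
        (ENNReal.ofReal (2 * TT lam mu ε x y * (8 * ρ) ^ n)) * volume R := by
      calc ENNReal.ofReal (moll u φ x) * volume R
          ≤ ENNReal.ofReal (moll u φ x) * (2 * volume Z) := by gcongr
        _ = 2 * ∫⁻ z in Z, ENNReal.ofReal (moll u φ x) := by rw [setLIntegral_const]; ring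
        _ = 2 * ∫⁻ z in Z, ENNReal.ofReal (moll u φ x - moll u φ z) := by
            congr 1
            refine setLIntegral_congr_fun hZm fun z hzZ => ?_
            simp only [hzero z hzZ, sub_zero]
        _ ≤ 2 * (ENNReal.ofReal (TT lam mu ε x y) * (volume R * ENNReal.ofReal (8 * ρ) ^ n)) := by
            gcongr
        _ = _ := by
            rw [ofReal_split hT hρ.le]; ring
    have h4 := (ENNReal.mul_le_mul_iff_left hv0 hvt).1 h3
    have h5 := (ENNReal.ofReal_le_ofReal_iff (by positivity)).1 h4
    linarith
  refine (TT_limit key).trans (le_of_eq ?_)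
  rw [dAsV_eq, dAsV_eq]
  ring

lemma bdry_case {n : ℕ} {Ω : Set (Fin n → ℝ)} (hO : IsOpen Ω) (hΩ : Convex ℝ Ω)
    {u : (Fin n → ℝ) → ℝ} {g : (Fin n → ℝ) → (Fin n → ℝ)}
    (hu : LocallyIntegrable u volume) (hg : LocallyIntegrable g volume) (hw : IsWeakGrad u g)
    (hz : ∀ x, x ∉ Ω → u x = 0)
    {x y : Fin n → ℝ} {lam mu : ℝ} (hl : 0 < lam) (hm : 0 < mu)
    (hx1 : strongMax (fun w => ‖fun i => max (g w i) 0‖) x ≤ ENNReal.ofReal lam)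
    (hx2 : strongMax (fun w => ‖fun i => max (-(g w i)) 0‖) x ≤ ENNReal.ofReal mu)
    (hxΩ : x ∈ Ω) (hx : LebPoint u x) (hy : y ∈ frontier Ω) :
    u x ≤ dAsV (4 * 4 ^ n * lam) (4 * 4 ^ n * mu) x y := by
  have hcl : IsClosed {y | u x ≤ dAsV (4 * 4 ^ n * lam) (4 * 4 ^ n * mu) x y} := by
    simp only [dAsV_eq]
    exact isClosed_le continuous_const (by fun_prop)
  have hyc : y ∈ closure (closure Ω)ᶜ := by
    rw [closure_compl, hΩ.interior_closure_eq_interior_of_nonempty_interior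
      (by rw [hO.interior_eq]; exact ⟨x, hxΩ⟩)]
    exact hy.2
  exact closure_minimal (fun y hy => outer_case hΩ hu hg hw hz hl hm hx1 hx2 hx hy) hcl hyc

/-- Boundary version of the asymmetric Lipschitz estimate: for a convex open `Ω` and
`u ∈ W^{1,1}_0(Ω)` (extended by zero), `u` is asymmetrically `(Cλ, Cμ)`-Lipschitz
on `Y = (X ∩ Ω) ∪ ∂Ω` where `X = {N(∇u)₊ ≤ λ} ∩ {N(∇u)₋ ≤ μ}`. -/
theorem stmt13 (n : ℕ) :
    ∃ C : ℝ, 0 < C ∧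
      ∀ (Ω : Set (Fin n → ℝ)), IsOpen Ω → Convex ℝ Ω →
      ∀ (u : (Fin n → ℝ) → ℝ) (g : (Fin n → ℝ) → (Fin n → ℝ)),
        LocallyIntegrable u volume → LocallyIntegrable g volume → IsWeakGrad u g →
        (∀ x, x ∉ Ω → u x = 0) →
        ∀ lam mu : ℝ, 0 < lam → 0 < mu →
          ∀ x y,
            x ∈ ({z | strongMax (fun w => ‖fun i => max (g w i) 0‖) z ≤ ENNReal.ofReal lam} ∩
                  {z | strongMax (fun w => ‖fun i => max (-(g w i)) 0‖) z ≤ ENNReal.ofReal mu} ∩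
                  Ω) ∪ frontier Ω →
            y ∈ ({z | strongMax (fun w => ‖fun i => max (g w i) 0‖) z ≤ ENNReal.ofReal lam} ∩
                  {z | strongMax (fun w => ‖fun i => max (-(g w i)) 0‖) z ≤ ENNReal.ofReal mu} ∩
                  Ω) ∪ frontier Ω →
            (x ∈ Ω → LebPoint u x) → (y ∈ Ω → LebPoint u y) →
            u x - u y ≤ dAsV (C * lam) (C * mu) x y := by
  refine ⟨4 * 4 ^ n, by positivity, ?_⟩
  intro Ω hO hΩ u g hu hg hw hz lam mu hl hm x y hx hy hLx hLy
  have hfr : ∀ z ∈ frontier Ω, u z = 0 := fun z hzf => hz z fun h => by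
    rw [hO.frontier_eq] at hzf; exact hzf.2 h
  rcases hx with ⟨⟨hx1, hx2⟩, hxΩ⟩ | hx <;> rcases hy with ⟨⟨hy1, hy2⟩, hyΩ⟩ | hy
  · exact interior_case hu hg hw hl hm hx1 hx2 hy1 hy2 (hLx hxΩ) (hLy hyΩ)
  · rw [hfr y hy, sub_zero]
    exact bdry_case hO hΩ hu hg hw hz hl hm hx1 hx2 hxΩ (hLx hxΩ) hy
  · rw [hfr x hx, zero_sub, dAsV_swap]
    exact bdry_case hO hΩ hu.neg hg.neg (weak_neg hw) (fun z hzn => by simp [hz z hzn]) hm hl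
      hy2 (by simpa using hy1) hyΩ (leb_neg (hLy hyΩ)) hx
  · rw [hfr x hx, hfr y hy, sub_zero]
    exact dAsV_nonneg (by positivity) (by positivity) x y
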